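/- Let F₁ be a finite-dimensional C*-algebra, let F₂ = M_{r₁} ⊕ ⋯ ⊕ M_{r_k} be a direct sum of complex matrix algebras, let φ₀, φ₁ : F₁ → F₂ be *-homomorphisms, and let (g, a) be a positive element of norm 1 in the Elliott–Thomsen building block A(F₁, F₂, φ₀, φ₁). Suppose that for each j the j-th component of g has the form g_j(t) = Σ_{i=1}^{r_j} λ_{i,j}(t)·p_{i,j}(t), where the functions λ_{i,j} : [0,1] → [0,∞) are continuous and the p_{i,j} : [0,1] → M_{r_j} are continuous, mutually orthogonal, rank-one projection-valued functions. Then for every ε > 0 there exists h ∈ C([0,1], F₂) with 0 ≤ h ≤ g and ‖h − g‖ < ε such that (h, a) ∈ A(F₁, F₂, φ₀, φ₁) and, for each j, the range projections P_j(t) of the components h_j(t) satisfy: there is a partition 0 = t_j⁰ < t_j¹ < ⋯ < t_j^{n_j} = 1 such that (1) on each open interval (t_j^l, t_j^{l+1}) the map t ↦ P_j(t) is continuous and P_j(t) has constant rank; (2) at each partition point the one-sided limits of P_j exist; (3) P_j(t_j^l) is dominated by each of these one-sided limits; (4) π^j(φ₀(p)) = P_j(0) = P_j(0⁺) and π^j(φ₁(p))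 = P_j(1) = P_j(1⁻), where p ∈ F₁ is the range projection of a and π^j : F₂ → M_{r_j} is the j-th coordinate projection. -/

import Mathlib

open unitInterval

set_option maxHeartbeats 1000000
set_option synthInstance.maxHeartbeats 400000

noncomputable section

/-- The full matrix algebra `M_r(ℂ)`, realized as the C⋆-algebra of operators on the
`r`-dimensional complex Hilbert space. -/
abbrev MatAlg (r : ℕ) : Type :=
  EuclideanSpace ℂ (Fin r) →L[ℂ] EuclideanSpace ℂ (Fin r)

/-- The rank of an element of `M_r(ℂ)`. -/
def matRank {r : ℕ} (T : MatAlg r) : ℕ :=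
  Module.finrank ℂ (LinearMap.range (T : EuclideanSpace ℂ (Fin r) →ₗ[ℂ] EuclideanSpace ℂ (Fin r)))

/-- `p` is the range projection of the positive element `x`: `p` is a projection with `p x = x`
which is dominated by every projection `q` with `q x = x` (equivalently, `p` is the spectral
projection of `x` corresponding to the nonzero part of the spectrum). -/
def IsRangeProjection {M : Type*} [NonUnitalSemiring M] [StarRing M] (x p : M) : Prop :=
  IsSelfAdjoint p ∧ p * p = p ∧ p * x = x ∧
    ∀ q : M, IsSelfAdjoint q → q * q = q → q * x = x → p * q = p

/-- The Elliott–Thomsen building block `A(F₁, F₂, φ₀, φ₁)`, realized as the subset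
`{(f, g) ∈ C([0,1], F₂) ⊕ F₁ : f 0 = φ₀ g ∧ f 1 = φ₁ g}` of `C([0,1], F₂) × F₁`. -/
def ETBlock {F₁ F₂ : Type*} [CStarAlgebra F₁] [CStarAlgebra F₂]
    (φ₀ φ₁ : F₁ →⋆ₙₐ[ℂ] F₂) : Set (C(I, F₂) × F₁) :=
  {p | p.1 0 = φ₀ p.2 ∧ p.1 1 = φ₁ p.2}

/-- The conditions (1)–(4) on the range projections `P j` of the components of an element of a
building block, relative to partitions `0 = t 0 < t 1 < ⋯ < t (m+1) = 1` of `[0,1]`: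
(1) on each open subinterval `P j` is continuous of constant rank; (2) one-sided limits
`Pp l` (from the right) and `Pm l` (from the left) exist at the partition points;
(3) `P j (t l)` is dominated by these one-sided limits; (4) at the endpoints, `P j` agrees with
the `j`-th components `p0 j`, `p1 j` of the boundary projections and with the corresponding
one-sided limits. -/
def RangeProjPartitionCond {k : ℕ} (r : Fin k → ℕ)
    (P : ∀ j : Fin k, I → MatAlg (r j)) (p0 p1 : ∀ j : Fin k, MatAlg (r j)) : Prop :=
  ∀ j : Fin k, ∃ (m : ℕ) (t : Fin (m + 2) → I) (Pp Pm : Fin (m + 2) → MatAlg (r j)),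
    StrictMono t ∧ t 0 = 0 ∧ t (Fin.last (m + 1)) = 1 ∧
    (∀ l : Fin (m + 1),
      ContinuousOn (P j) (Set.Ioo (t l.castSucc) (t l.succ)) ∧
      ∃ c : ℕ, ∀ s ∈ Set.Ioo (t l.castSucc) (t l.succ), matRank (P j s) = c) ∧
    (∀ l : Fin (m + 2), t l < 1 →
      Filter.Tendsto (P j) (nhdsWithin (t l) (Set.Ioi (t l))) (nhds (Pp l))) ∧
    (∀ l : Fin (m + 2), 0 < t l →
      Filter.Tendsto (P j) (nhdsWithin (t l) (Set.Iio (t l))) (nhds (Pm l))) ∧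
    (∀ l : Fin (m + 2), t l < 1 → (Pp l - P j (t l)).IsPositive) ∧
    (∀ l : Fin (m + 2), 0 < t l → (Pm l - P j (t l)).IsPositive) ∧
    (p0 j = P j 0 ∧ P j 0 = Pp 0) ∧
    (p1 j = P j 1 ∧ P j 1 = Pm (Fin.last (m + 1)))

section RangeProjection

variable {M : Type*} [NonUnitalSemiring M] [StarRing M]

lemma isRangeProjection_of_eq_mul {x p c : M} (hs : IsSelfAdjoint p) (hi : p * p = p)
    (hx : p * x = x) (hc : p = x * c) : IsRangeProjection x p := by
  refine ⟨hs, hi, hx, fun q hq _ hqx => ?_⟩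
  have h : q * p = p := by rw [hc, ← mul_assoc, hqx]
  simpa [hs.star_eq, hq.star_eq] using congrArg star h

lemma IsRangeProjection.unique {x p q : M} (hp : IsRangeProjection x p)
    (hq : IsRangeProjection x q) : p = q := by
  obtain ⟨hps, hpi, hpx, hpm⟩ := hp
  obtain ⟨hqs, hqi, hqx, hqm⟩ := hq
  have h1 := hpm q hqs hqi hqx
  have h2 := congrArg star (hqm p hps hpi hpx)
  rw [star_mul, hps.star_eq, hqs.star_eq] at h2
  exact h1.symm.trans h2

end RangeProjection

lemma finite_spectrum_of_finiteDimensional {A : Type*} [Ring A] [Algebra ℂ A]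
    [FiniteDimensional ℂ A] (a : A) : (spectrum ℂ a).Finite := by
  cases subsingleton_or_nontrivial A
  · rw [spectrum.of_subsingleton]
    exact Set.finite_empty
  have hne : minpoly ℂ a ≠ 0 := minpoly.ne_zero (Algebra.IsIntegral.isIntegral a)
  refine ((minpoly ℂ a).rootSet_finite ℂ).subset fun z hz => ?_
  have h := spectrum.subset_polynomial_aeval a (minpoly ℂ a) ⟨z, hz, rfl⟩
  rw [minpoly.aeval, spectrum.zero_eq] at h
  rw [Polynomial.mem_rootSet]
  exact ⟨hne, by simpa using h⟩

lemma exists_projection_eq_mul {A : Type*} [CStarAlgebra A] [FiniteDimensional ℂ A] (a : A)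
    (ha : IsSelfAdjoint a) :
    ∃ q c : A, IsSelfAdjoint q ∧ q * q = q ∧ q * a = a ∧ q = a * c := by
  have hn : IsStarNormal a := ha.isStarNormal
  have hc : ∀ f : ℂ → ℂ, ContinuousOn f (spectrum ℂ a) := fun f =>
    (finite_spectrum_of_finiteDimensional a).continuousOn f
  refine ⟨cfc (fun z : ℂ => z * z⁻¹) a, cfc (fun z : ℂ => z⁻¹) a, ?_, ?_, ?_, ?_⟩
  · rw [IsSelfAdjoint, ← cfc_star]
    congr 1
    ext z
    by_cases hz : z = 0 <;> simp [hz]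
  · rw [← cfc_mul _ _ a (hc _) (hc _)]
    congr 1
    ext z
    by_cases hz : z = 0 <;> simp [hz]
  · conv_lhs => rw [← cfc_id ℂ a, cfc_id ℂ a]
    nth_rewrite 2 [← cfc_id ℂ a]
    rw [← cfc_mul _ _ a (hc _) (hc _)]
    conv_rhs => rw [← cfc_id ℂ a]
    congr 1
    ext z
    by_cases hz : z = 0 <;> simp [hz]
  · nth_rewrite 2 [← cfc_id ℂ a]
    rw [← cfc_mul _ _ a (hc _) (hc _)]
    rfl

section OrthogonalProjections

variable {r : ℕ} {p : Fin r → MatAlg r}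

lemma sum_smul_mul_sum_smul {A ι : Type*} [Ring A] [Algebra ℂ A] [Fintype ι] {p : ι → A}
    (hi : ∀ i, p i * p i = p i) (ho : ∀ i j, i ≠ j → p i * p j = 0) (a b : ι → ℂ) :
    (∑ i, a i • p i) * (∑ i, b i • p i) = ∑ i, (a i * b i) • p i := by
  classical
  rw [Finset.sum_mul_sum]
  refine Finset.sum_congr rfl fun i _ => ?_
  rw [Finset.sum_eq_single i]
  · rw [smul_mul_smul_comm, hi]
  · intro j _ hj
    rw [smul_mul_smul_comm, ho i j hj.symm, smul_zero]
  · simp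

lemma isPositive_sum_smul (hs : ∀ i, IsSelfAdjoint (p i)) (hi : ∀ i, p i * p i = p i)
    {a : Fin r → ℝ} (ha : ∀ i, 0 ≤ a i) : (∑ i, (a i : ℂ) • p i).IsPositive := by
  refine Finset.sum_induction _ ContinuousLinearMap.IsPositive (fun _ _ h h' => h.add h')
    ContinuousLinearMap.isPositive_zero fun i _ => ?_
  exact (ContinuousLinearMap.IsPositive.of_isStarProjection ⟨hi i, hs i⟩).smul_of_nonneg
    (by exact_mod_cast ha i)

lemma isRangeProjection_sum_smul {A ι : Type*} [Ring A] [StarRing A] [Algebra ℂ A]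
    [StarModule ℂ A] [Fintype ι] {p : ι → A} (hs : ∀ i, IsSelfAdjoint (p i))
    (hi : ∀ i, p i * p i = p i) (ho : ∀ i j, i ≠ j → p i * p j = 0)
    (a : ι → ℝ) (s : ι → Prop) [DecidablePred s] (has : ∀ i, s i ↔ a i ≠ 0) :
    IsRangeProjection (∑ i, (a i : ℂ) • p i) (∑ i, (if s i then 1 else 0 : ℂ) • p i) := by
  refine isRangeProjection_of_eq_mul (c := ∑ i, ((a i)⁻¹ : ℂ) • p i) ?_ ?_ ?_ ?_
  · rw [IsSelfAdjoint, star_sum]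
    refine Finset.sum_congr rfl fun i _ => ?_
    rw [star_smul, (hs i).star_eq]
    split_ifs <;> simp
  all_goals
    rw [sum_smul_mul_sum_smul hi ho]
    refine Finset.sum_congr rfl fun i _ => ?_
    have h := has i
    by_cases h0 : a i = 0 <;> simp_all

lemma matRank_eq_trace {T : MatAlg r} (hT : T * T = T) :
    (matRank T : ℂ) = LinearMap.trace ℂ _ (T : EuclideanSpace ℂ (Fin r) →ₗ[ℂ] _) := by
  have h : IsIdempotentElem (T : EuclideanSpace ℂ (Fin r) →ₗ[ℂ] EuclideanSpace ℂ (Fin r)) := by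
    ext1 x
    exact congrArg (fun S : MatAlg r => S x) hT
  exact (LinearMap.IsIdempotentElem.isProj_range _ h).trace.symm

lemma matRank_sum_ite (hi : ∀ i, p i * p i = p i)
    (ho : ∀ i j, i ≠ j → p i * p j = 0) (h1 : ∀ i, matRank (p i) = 1) (s : Fin r → Prop)
    [DecidablePred s] :
    matRank (∑ i, (if s i then 1 else 0 : ℂ) • p i) = ∑ i, if s i then 1 else 0 := by
  have hT : (∑ i, (if s i then 1 else 0 : ℂ) • p i) * (∑ i, (if s i then 1 else 0 : ℂ) • p i) =
      ∑ i, (if s i then 1 else 0 : ℂ) • p i := by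
    rw [sum_smul_mul_sum_smul hi ho]
    refine Finset.sum_congr rfl fun i _ => ?_
    split_ifs
    · rw [mul_one]
    · rw [mul_zero]
  have h := matRank_eq_trace hT
  have hsum : ((∑ i, (if s i then 1 else 0 : ℂ) • p i : MatAlg r) :
      EuclideanSpace ℂ (Fin r) →ₗ[ℂ] EuclideanSpace ℂ (Fin r)) =
      ∑ i, (if s i then 1 else 0 : ℂ) •
        (p i : EuclideanSpace ℂ (Fin r) →ₗ[ℂ] EuclideanSpace ℂ (Fin r)) := by
    ext1 x
    rw [ContinuousLinearMap.coe_coe, _root_.sum_apply, LinearMap.sum_apply]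
    rfl
  rw [hsum, map_sum] at h
  simp_rw [map_smul, ← matRank_eq_trace (hi _), h1] at h
  have h' : ((∑ i, if s i then 1 else 0 : ℕ) : ℂ) = ∑ i, if s i then 1 else 0 := by
    push_cast
    rfl
  exact_mod_cast (by rw [h, h']; simp :
    ((matRank (∑ i, (if s i then 1 else 0 : ℂ) • p i) : ℕ) : ℂ) =
      ((∑ i, if s i then 1 else 0 : ℕ) : ℂ))

lemma isPositive_sum_ite_sub (hs : ∀ i, IsSelfAdjoint (p i)) (hi : ∀ i, p i * p i = p i)
    {s s' : Fin r → Prop} [DecidablePred s] [DecidablePred s'] (h : ∀ i, s' i → s i) :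
    ((∑ i, (if s i then 1 else 0 : ℂ) • p i) -
      ∑ i, (if s' i then 1 else 0 : ℂ) • p i).IsPositive := by
  have hpos := isPositive_sum_smul hs hi
    (a := fun i => (if s i then 1 else 0) - (if s' i then 1 else 0)) fun i => by
      have := h i
      split_ifs <;> simp_all
  rw [← Finset.sum_sub_distrib]
  convert hpos using 3 with i
  refine (sub_smul _ _ _).symm.trans ?_
  congr 1
  split_ifs <;> simp

end OrthogonalProjections

section Minorant

/-- The closed interval `[l/N, (l+1)/N]`. -/
def gridCell (N l : ℕ) : Set ℝ := Set.Icc ((l : ℝ) / N) ((l + 1) / N)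

lemma exists_minorant {N : ℕ} (hN : 0 < N) (f : C(I, ℝ)) (hf : ∀ t, 0 ≤ f t) {δ : ℝ}
    (hδ : 0 < δ) (hosc : ∀ s t : I, |(s : ℝ) - t| ≤ 1 / N → |f s - f t| < δ)
    (h0 : f 0 = 0 ∨ 2 * δ ≤ f 0) (h1 : f 1 = 0 ∨ 2 * δ ≤ f 1) :
    ∃ (μ : C(I, ℝ)) (S : ℕ → Prop),
      (∀ t, 0 ≤ μ t) ∧ (∀ t, μ t ≤ f t) ∧ (∀ t, f t - μ t ≤ 3 * δ) ∧ μ 0 = f 0 ∧ μ 1 = f 1 ∧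
      (∀ l < N, ∀ t : I, (t : ℝ) ∈ gridCell N l → 0 < μ t → S l) ∧
      (∀ l < N, ∀ t : I, (t : ℝ) ∈ interior (gridCell N l) → S l → 0 < μ t) ∧
      (S 0 → 0 < μ 0) ∧ (S (N - 1) → 0 < μ 1) := by
  classical
  have hN' : (0 : ℝ) < N := by exact_mod_cast hN
  have hN1 : (1 : ℝ) ≤ N := by exact_mod_cast hN
  set S : ℕ → Prop := fun l => ∀ s : I, (s : ℝ) ∈ gridCell N l → δ ≤ f s with hS
  -- the extra point makes the set nonempty without affecting distances below `1`
  set Z : Set ℝ := {-1} ∪ ⋃ l ∈ {l | l < N ∧ ¬ S l}, gridCell N l with hZ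
  have hZne : Z.Nonempty := ⟨-1, Or.inl rfl⟩
  have hZc : IsClosed Z := by
    refine isClosed_singleton.union (Set.Finite.isClosed_biUnion ?_ fun _ _ => isClosed_Icc)
    exact (Set.finite_lt_nat N).subset fun l hl => hl.1
  have hmem : ∀ z ∈ Z, z ≠ -1 → ∃ l < N, ¬ S l ∧ z ∈ gridCell N l := by
    rintro z (hz | hz) hne
    · exact absurd hz hne
    · simpa [and_assoc] using hz
  have hcell : ∀ l, ∀ s ∈ gridCell N l, ∀ t ∈ gridCell N l, |s - t| ≤ 1 / N := by
    intro l s hs t ht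
    have h3 : ((l : ℝ) + 1) / N = l / N + 1 / N := add_div _ _ _
    have := hs.1; have := hs.2; have := ht.1; have := ht.2
    rw [abs_le]
    constructor <;> linarith
  have hbad : ∀ l, ¬ S l → ∀ t : I, (t : ℝ) ∈ gridCell N l → f t < 2 * δ := by
    intro l hl t ht
    simp only [hS, not_forall, not_le] at hl
    obtain ⟨s, hs, hfs⟩ := hl
    have := (abs_lt.1 (hosc t s (hcell l _ ht _ hs))).2
    linarith
  have hunit : ∀ l < N, ∀ z ∈ gridCell N l, z ∈ Set.Icc (0 : ℝ) 1 := by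
    intro l hl z hz
    have hl' : (l : ℝ) + 1 ≤ N := by exact_mod_cast hl
    refine ⟨le_trans (by positivity) hz.1, hz.2.trans ?_⟩
    rwa [div_le_one hN']
  have hdist : ∀ t : I, 0 ≤ Metric.infDist (t : ℝ) Z := fun t => Metric.infDist_nonneg
  set χ : I → ℝ := fun t => min 1 (N * Metric.infDist (t : ℝ) Z) with hχ
  have hχc : Continuous χ := by
    have := (Metric.continuous_infDist_pt Z).comp (continuous_subtype_val (p := (· ∈ I)))
    exact continuous_const.min (continuous_const.mul this)
  have hχ0 : ∀ t, 0 ≤ χ t := fun t => le_min zero_le_one (mul_nonneg hN'.le (hdist t))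
  have hχ1 : ∀ t, χ t ≤ 1 := fun t => min_le_left _ _
  have hχfar : ∀ t : I, (∀ z ∈ Z, 1 / N ≤ |(t : ℝ) - z|) → χ t = 1 := by
    intro t ht
    refine min_eq_left ?_
    have : 1 / N ≤ Metric.infDist (t : ℝ) Z := (Metric.le_infDist hZne).2 fun {z} hz => ht z hz
    rw [div_le_iff₀ hN'] at this
    linarith
  have hfarpt : ∀ t : I, 1 / N ≤ |(t : ℝ) - (-1)| := by
    intro t
    have := t.2.1
    rw [abs_of_nonneg (by linarith)]
    have : 1 / (N : ℝ) ≤ 1 := by rwa [div_le_one hN']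
    linarith
  have hmem0 : ((0 : I) : ℝ) ∈ gridCell N 0 := by
    simp [gridCell]
  have hmem1 : ((1 : I) : ℝ) ∈ gridCell N (N - 1) := by
    rw [gridCell, Nat.cast_sub hN]
    constructor
    · rw [Set.Icc.coe_one, div_le_one hN']; simp
    · rw [Set.Icc.coe_one, le_div_iff₀ hN']; simp
  have hχS0 : S 0 → χ 0 = 1 := by
    intro h
    refine hχfar 0 fun z hz => ?_
    by_cases hz1 : z = -1
    · rw [hz1]; exact hfarpt 0
    obtain ⟨l, hl, hSl, hzl⟩ := hmem z hz hz1
    have hl1 : 1 ≤ l := Nat.one_le_iff_ne_zero.2 fun h' => hSl (h' ▸ h)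
    have : (1 : ℝ) / N ≤ l / N := by gcongr; exact_mod_cast hl1
    have := hzl.1
    have h3 : (0 : ℝ) < 1 / N := by positivity
    rw [abs_sub_comm, abs_of_nonneg] <;> simp <;> [skip; linarith]
    rw [← one_div]; linarith
  have hχS1 : S (N - 1) → χ 1 = 1 := by
    intro h
    refine hχfar 1 fun z hz => ?_
    by_cases hz1 : z = -1
    · rw [hz1]; exact hfarpt 1
    obtain ⟨l, hl, hSl, hzl⟩ := hmem z hz hz1
    have hl1 : l + 1 + 1 ≤ N := by
      have : l ≠ N - 1 := fun h' => hSl (h' ▸ h)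
      omega
    have : ((l : ℝ) + 1) / N + 1 / N ≤ 1 := by
      rw [← add_div, div_le_one hN']; exact_mod_cast hl1
    have := hzl.2
    have h3 : (0 : ℝ) < 1 / N := by positivity
    have h4 : 1 / (N : ℝ) ≤ 1 - z := by linarith
    exact h4.trans (le_abs_self _)
  have hpos0 : S 0 → 0 < f 0 := fun h => hδ.trans_le (h 0 hmem0)
  have hpos1 : S (N - 1) → 0 < f 1 := fun h => hδ.trans_le (h 1 hmem1)
  refine ⟨⟨fun t => f t * χ t, f.continuous.mul hχc⟩, S, fun t => mul_nonneg (hf t) (hχ0 t),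
    fun t => mul_le_of_le_one_right (hf t) (hχ1 t), fun t => ?_, ?_, ?_, ?_, ?_, ?_, ?_⟩
  · change f t - f t * χ t ≤ 3 * δ
    by_cases hfar : ∀ z ∈ Z, 1 / N ≤ |(t : ℝ) - z|
    · rw [hχfar t hfar]; linarith
    · push Not at hfar
      obtain ⟨z, hz, htz⟩ := hfar
      have hz1 : z ≠ -1 := fun h => (hfarpt t).not_gt (h ▸ htz)
      obtain ⟨l, hl, hSl, hzl⟩ := hmem z hz hz1
      have h2 := hbad l hSl ⟨z, hunit l hl z hzl⟩ hzl
      have h3 := (abs_lt.1 (hosc t ⟨z, hunit l hl z hzl⟩ htz.le)).2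
      have h4 := mul_nonneg (hf t) (hχ0 t)
      linarith
  · change f 0 * χ 0 = f 0
    rcases h0 with h | h
    · simp [h]
    · rw [hχS0, mul_one]
      by_contra hS0
      exact (hbad 0 hS0 0 hmem0).not_ge h
  · change f 1 * χ 1 = f 1
    rcases h1 with h | h
    · simp [h]
    · rw [hχS1, mul_one]
      by_contra hS1
      exact (hbad _ hS1 1 hmem1).not_ge h
  · intro l hl t ht hpos
    by_contra hSl
    have htZ : (t : ℝ) ∈ Z :=
      Or.inr (Set.mem_biUnion (show l ∈ {l | l < N ∧ ¬ S l} from ⟨hl, hSl⟩) ht)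
    have : χ t = 0 := by simp [hχ, Metric.infDist_zero_of_mem htZ]
    change 0 < f t * χ t at hpos
    simp [this] at hpos
  · intro l hl t ht hSl
    have ht' := interior_subset ht
    refine mul_pos (hδ.trans_le (hSl t ht')) (lt_min one_pos (mul_pos hN' ?_))
    refine (hZc.notMem_iff_infDist_pos hZne).1 fun htZ => ?_
    have ht1 : (t : ℝ) ≠ -1 := fun h => by linarith [t.2.1]
    obtain ⟨l', hl', hSl', htl'⟩ := hmem t htZ ht1
    rw [gridCell, interior_Icc] at ht
    have e1 := lt_of_lt_of_le ht.1 htl'.2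
    have e2 := lt_of_le_of_lt htl'.1 ht.2
    rw [div_lt_div_iff_of_pos_right hN'] at e1 e2
    have e3 : l < l' + 1 := by exact_mod_cast e1
    have e4 : l' < l + 1 := by exact_mod_cast e2
    have : l = l' := by omega
    exact hSl' (this ▸ hSl)
  · intro h
    change 0 < f 0 * χ 0
    rw [hχS0 h, mul_one]
    exact hpos0 h
  · intro h
    change 0 < f 1 * χ 1
    rw [hχS1 h, mul_one]
    exact hpos1 h

end Minorant

lemma exists_rangeProjection_partition {r m : ℕ} (p : Fin r → C(I, MatAlg r))
    (hs : ∀ i t, IsSelfAdjoint (p i t)) (hi : ∀ i t, p i t * p i t = p i t)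
    (ho : ∀ i i', i ≠ i' → ∀ t, p i t * p i' t = 0) (hr : ∀ i t, matRank (p i t) = 1)
    (μ : Fin r → C(I, ℝ)) [∀ t, DecidablePred fun i => 0 < μ i t] (S : Fin r → ℕ → Prop)
    (hcell : ∀ i, ∀ l < m + 1, ∀ t : I, (t : ℝ) ∈ gridCell (m + 1) l → 0 < μ i t → S i l)
    (hint : ∀ i, ∀ l < m + 1, ∀ t : I, (t : ℝ) ∈ interior (gridCell (m + 1) l) →
      S i l → 0 < μ i t)
    (h0 : ∀ i, S i 0 → 0 < μ i 0) (h1 : ∀ i, S i m → 0 < μ i 1)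
    (P : I → MatAlg r) (hP : ∀ t, P t = ∑ i, (if 0 < μ i t then 1 else 0 : ℂ) • p i t) :
    ∃ (t : Fin (m + 2) → I) (Pp Pm : Fin (m + 2) → MatAlg r),
      StrictMono t ∧ t 0 = 0 ∧ t (Fin.last (m + 1)) = 1 ∧
      (∀ l : Fin (m + 1),
        ContinuousOn P (Set.Ioo (t l.castSucc) (t l.succ)) ∧
        ∃ c : ℕ, ∀ s ∈ Set.Ioo (t l.castSucc) (t l.succ), matRank (P s) = c) ∧
      (∀ l : Fin (m + 2), t l < 1 →
        Filter.Tendsto P (nhdsWithin (t l) (Set.Ioi (t l))) (nhds (Pp l))) ∧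
      (∀ l : Fin (m + 2), 0 < t l →
        Filter.Tendsto P (nhdsWithin (t l) (Set.Iio (t l))) (nhds (Pm l))) ∧
      (∀ l : Fin (m + 2), t l < 1 → (Pp l - P (t l)).IsPositive) ∧
      (∀ l : Fin (m + 2), 0 < t l → (Pm l - P (t l)).IsPositive) ∧
      P 0 = Pp 0 ∧ P 1 = Pm (Fin.last (m + 1)) := by
  classical
  have hN : (0 : ℝ) < ((m + 1 : ℕ) : ℝ) := by positivity
  set Q : ℕ → I → MatAlg r := fun l t => ∑ i, (if S i l then 1 else 0 : ℂ) • p i t with hQ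
  have hQc : ∀ l, Continuous (Q l) := fun l =>
    continuous_finsetSum _ fun i _ =>
      (p i).continuous.const_smul (if S i l then 1 else 0 : ℂ)
  set t : Fin (m + 2) → I := fun l => ⟨(l : ℕ) / ((m + 1 : ℕ) : ℝ), by positivity, by
    rw [div_le_one hN]
    exact_mod_cast Nat.lt_succ_iff.1 l.2⟩ with ht
  have htc : ∀ l, (t l : ℝ) = (l : ℕ) / ((m + 1 : ℕ) : ℝ) := fun l => rfl
  have htmono : StrictMono t := by
    intro l l' hl
    rw [← Subtype.coe_lt_coe, htc, htc, div_lt_div_iff_of_pos_right hN]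
    exact_mod_cast hl
  have ht0 : t 0 = 0 := by
    ext
    simp [htc]
  have ht1 : t (Fin.last (m + 1)) = 1 := by
    ext
    rw [htc, Fin.val_last, Set.Icc.coe_one, div_self hN.ne']
  have hPQ : ∀ l : Fin (m + 1), Set.EqOn P (Q l) (Set.Ioo (t l.castSucc) (t l.succ)) := by
    intro l s hsl
    have hmem : (s : ℝ) ∈ interior (gridCell (m + 1) l) := by
      rw [gridCell, interior_Icc]
      have e1 : (t l.castSucc : ℝ) < s := hsl.1
      have e2 : (s : ℝ) < t l.succ := hsl.2
      rw [htc] at e1 e2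
      exact ⟨e1, by simpa using e2⟩
    rw [hP]
    refine Finset.sum_congr rfl fun i _ => ?_
    have : 0 < μ i s ↔ S i l :=
      ⟨hcell i l l.2 s (interior_subset hmem), hint i l l.2 s hmem⟩
    simp only [this]
  have hPQle : ∀ (l : ℕ) (s : I), l < m + 1 → (s : ℝ) ∈ gridCell (m + 1) l →
      (Q l s - P s).IsPositive := by
    intro l s hl hsl
    rw [hP]
    exact isPositive_sum_ite_sub (fun i => hs i s) (fun i => hi i s)
      fun i => hcell i l hl s hsl
  have hlast : ∀ l : Fin (m + 2), t l < 1 → ∃ l' : Fin (m + 1), l = l'.castSucc := by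
    intro l hl
    rw [← ht1, htmono.lt_iff_lt] at hl
    exact ⟨l.castPred hl.ne, by simp⟩
  have hfirst : ∀ l : Fin (m + 2), 0 < t l → ∃ l' : Fin (m + 1), l = l'.succ := by
    intro l hl
    rw [← ht0, htmono.lt_iff_lt] at hl
    exact ⟨l.pred hl.ne', by simp⟩
  have hlt : ∀ l : Fin (m + 1), t l.castSucc < t l.succ := fun l => htmono l.castSucc_lt_succ
  refine ⟨t, fun l => Q l (t l), fun l => Q (l - 1) (t l), htmono, ht0, ht1, fun l => ⟨?_, ?_⟩,
    fun l hl => ?_, fun l hl => ?_, fun l hl => ?_, fun l hl => ?_, ?_, ?_⟩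
  · exact (hQc l).continuousOn.congr (hPQ l)
  · refine ⟨∑ i, if S i l then 1 else 0, fun s hsl => ?_⟩
    rw [hPQ l hsl]
    exact matRank_sum_ite (fun i => hi i s) (fun i i' h => ho i i' h s) (fun i => hr i s) _
  · obtain ⟨l, rfl⟩ := hlast l hl
    refine ((hQc l).tendsto (t l.castSucc)).mono_left nhdsWithin_le_nhds |>.congr' ?_
    filter_upwards [Ioo_mem_nhdsGT (hlt l)] with s hsl using (hPQ l hsl).symm
  · obtain ⟨l, rfl⟩ := hfirst l hl
    refine ((hQc l).tendsto (t l.succ)).mono_left nhdsWithin_le_nhds |>.congr' ?_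
    filter_upwards [Ioo_mem_nhdsLT (hlt l)] with s hsl using (hPQ l hsl).symm
  · obtain ⟨l, rfl⟩ := hlast l hl
    refine hPQle l _ l.2 ⟨le_rfl, ?_⟩
    rw [htc, Fin.val_castSucc]
    gcongr
    linarith
  · obtain ⟨l, rfl⟩ := hfirst l hl
    refine hPQle l _ l.2 ?_
    rw [htc, Fin.val_succ, gridCell]
    push_cast
    exact ⟨by gcongr; linarith, le_rfl⟩
  · rw [hP]
    simp only [ht0]
    refine Finset.sum_congr rfl fun i _ => ?_
    have : 0 < μ i 0 ↔ S i 0 := ⟨hcell i 0 m.succ_pos 0 ⟨by simp, by simp; positivity⟩, h0 i⟩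
    exact congrArg (fun z : ℂ => z • p i 0) (if_congr this rfl rfl)
  · rw [hP]
    simp only [ht1]
    refine Finset.sum_congr rfl fun i _ => ?_
    have : 0 < μ i 1 ↔ S i m := by
      refine ⟨hcell i m m.lt_succ_self 1 ⟨?_, ?_⟩, h1 i⟩
      · rw [Set.Icc.coe_one, div_le_one hN]
        simp
      · rw [Set.Icc.coe_one, le_div_iff₀ hN]
        simp
    exact congrArg (fun z : ℂ => z • p i 1) (if_congr this rfl rfl)

lemma IsSelfAdjoint.norm_le_one_of_mul_self {A : Type*} [NonUnitalNormedRing A] [StarRing A]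
    [CStarRing A] {p : A} (hs : IsSelfAdjoint p) (hi : p * p = p) : ‖p‖ ≤ 1 :=
  IsStarProjection.norm_le p ⟨hi, hs⟩

/-- A threshold `δ` which is small compared to `ε / n` and to the nonzero values of a finite family
of nonnegative numbers. -/
lemma exists_threshold {ι : Type*} [Finite ι] (x : ι → ℝ) (hx : ∀ i, 0 ≤ x i) (n : ℕ) {ε : ℝ}
    (hε : 0 < ε) : ∃ δ > 0, n * (3 * δ) < ε ∧ ∀ i, x i = 0 ∨ 2 * δ ≤ x i := by
  have hc : ∀ᶠ δ in nhdsWithin (0 : ℝ) (Set.Ioi 0),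
      n * (3 * δ) < ε ∧ ∀ i, x i = 0 ∨ 2 * δ ≤ x i := by
    refine Filter.Eventually.filter_mono nhdsWithin_le_nhds (Filter.Eventually.and ?_ ?_)
    · exact (Continuous.tendsto (by fun_prop) 0).eventually_lt_const (by simpa using hε)
    · refine Filter.eventually_all.2 fun i => ?_
      rcases (hx i).eq_or_lt with h | h
      · exact Filter.Eventually.of_forall fun _ => Or.inl h.symm
      · exact ((Continuous.tendsto (f := fun δ : ℝ => 2 * δ) (by fun_prop) 0).eventually_le_const
          (by simpa using h)).mono fun _ => Or.inr
  obtain ⟨δ, h, hδ⟩ := (hc.and self_mem_nhdsWithin).exists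
  exact ⟨δ, hδ, h⟩

lemma exists_common_mesh {ι : Type*} [Finite ι] (f : ι → C(I, ℝ)) {δ : ℝ} (hδ : 0 < δ) :
    ∃ m : ℕ, ∀ i, ∀ s t : I, |(s : ℝ) - t| ≤ 1 / (m + 1 : ℕ) → |f i s - f i t| < δ := by
  have : ∀ᶠ m : ℕ in Filter.atTop, ∀ i, ∀ s t : I,
      |(s : ℝ) - t| ≤ 1 / (m + 1 : ℕ) → |f i s - f i t| < δ := by
    refine Filter.eventually_all.2 fun i => ?_
    obtain ⟨η, hη, h⟩ := Metric.uniformContinuous_iff.1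
      (CompactSpace.uniformContinuous_of_continuous (f i).continuous) δ hδ
    filter_upwards [tendsto_one_div_add_atTop_nhds_zero_nat.eventually_lt_const hη]
      with m hm s t hst
    refine h (lt_of_le_of_lt hst ?_)
    simpa using hm
  exact this.exists

/-- Let `(g, a)` be a positive norm-one element of the Elliott–Thomsen building block
`A(F₁, ⊕ⱼ M_{r j}, φ₀, φ₁)` whose components decompose as
`g_j(t) = ∑ᵢ λ_{i,j}(t) • p_{i,j}(t)` with `λ_{i,j}` continuous nonnegative scalar functions and
`p_{i,j}` continuous mutually orthogonal rank-one projection-valued functions.  Then for every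
`ε > 0` there is `h` with `0 ≤ h ≤ g` (componentwise positivity), `‖h - g‖ < ε`,
`(h, a)` in the building block, whose range projections satisfy the partition
conditions (1)–(4). -/
theorem statement3
    {F₁ : Type} [CStarAlgebra F₁] [FiniteDimensional ℂ F₁]
    {k : ℕ} (r : Fin k → ℕ)
    (φ₀ φ₁ : F₁ →⋆ₙₐ[ℂ] (∀ j : Fin k, MatAlg (r j)))
    (g : C(I, ∀ j : Fin k, MatAlg (r j))) (a : F₁)
    (hmem : (g, a) ∈ ETBlock φ₀ φ₁)
    (hpos : ∃ s : C(I, ∀ j : Fin k, MatAlg (r j)) × F₁, (g, a) = star s * s)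
    (hnorm : ‖((g, a) : C(I, ∀ j : Fin k, MatAlg (r j)) × F₁)‖ = 1)
    (lam : ∀ j : Fin k, Fin (r j) → C(I, ℝ))
    (hlam : ∀ (j : Fin k) (i : Fin (r j)) (t : I), 0 ≤ lam j i t)
    (p : ∀ j : Fin k, Fin (r j) → C(I, MatAlg (r j)))
    (hproj : ∀ (j : Fin k) (i : Fin (r j)) (t : I),
      IsSelfAdjoint (p j i t) ∧ p j i t * p j i t = p j i t)
    (hrank1 : ∀ (j : Fin k) (i : Fin (r j)) (t : I), matRank (p j i t) = 1)
    (horth : ∀ (j : Fin k) (i i' : Fin (r j)), i ≠ i' → ∀ t : I, p j i t * p j i' t = 0)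
    (hdecomp : ∀ (t : I) (j : Fin k),
      g t j = ∑ i : Fin (r j), ((lam j i t : ℝ) : ℂ) • p j i t)
    (ε : ℝ) (hε : 0 < ε) :
    ∃ h : C(I, ∀ j : Fin k, MatAlg (r j)),
      (∀ (t : I) (j : Fin k), (h t j).IsPositive) ∧
      (∀ (t : I) (j : Fin k), (g t j - h t j).IsPositive) ∧
      ‖h - g‖ < ε ∧
      ((h, a) ∈ ETBlock φ₀ φ₁) ∧
      ∃ P : ∀ j : Fin k, I → MatAlg (r j),
        (∀ (j : Fin k) (t : I), IsRangeProjection (h t j) (P j t)) ∧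
        ∃ q : F₁, IsRangeProjection a q ∧ RangeProjPartitionCond r P (φ₀ q) (φ₁ q) := by
  classical
  obtain ⟨δ, hδ, hδε, hδx⟩ := exists_threshold
    (fun x : (Σ j, Fin (r j)) × Bool => lam x.1.1 x.1.2 (if x.2 then 1 else 0))
    (fun _ => hlam _ _ _) (∑ j, r j) hε
  obtain ⟨m, hm⟩ := exists_common_mesh (fun x : Σ j, Fin (r j) => lam x.1 x.2) hδ
  choose μ S hμ0 hμle hμδ hμz hμo hcell hint hSz hSo using fun (j : Fin k) (i : Fin (r j)) =>
    exists_minorant m.succ_pos (lam j i) (hlam j i) hδ (hm ⟨j, i⟩)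
      (by simpa using hδx (⟨j, i⟩, false)) (by simpa using hδx (⟨j, i⟩, true))
  have hs : ∀ j i t, IsSelfAdjoint (p j i t) := fun j i t => (hproj j i t).1
  have hi : ∀ j i t, p j i t * p j i t = p j i t := fun j i t => (hproj j i t).2
  let h : C(I, ∀ j : Fin k, MatAlg (r j)) :=
    ⟨fun t j => ∑ i, ((μ j i t : ℝ) : ℂ) • p j i t, continuous_pi fun j =>
      continuous_finsetSum _ fun i _ =>
        (Complex.continuous_ofReal.comp (μ j i).continuous).smul (p j i).continuous⟩
  have hh : ∀ t j, h t j = ∑ i, ((μ j i t : ℝ) : ℂ) • p j i t := fun _ _ => rfl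
  have hsub : ∀ t j, g t j - h t j = ∑ i, ((lam j i t - μ j i t : ℝ) : ℂ) • p j i t := by
    intro t j
    rw [hdecomp, hh, ← Finset.sum_sub_distrib]
    refine Finset.sum_congr rfl fun i _ => ?_
    rw [Complex.ofReal_sub]
    exact (sub_smul _ _ _).symm
  have hz : h 0 = g 0 := by
    ext1 j
    simp_rw [hh, hdecomp, hμz]
  have ho : h 1 = g 1 := by
    ext1 j
    simp_rw [hh, hdecomp, hμo]
  obtain ⟨hg0, hg1⟩ : g 0 = φ₀ a ∧ g 1 = φ₁ a := hmem
  have ha : IsSelfAdjoint a := by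
    obtain ⟨s, hs⟩ := hpos
    have : a = star s.2 * s.2 := congrArg Prod.snd hs
    rw [this]
    exact IsSelfAdjoint.star_mul_self _
  obtain ⟨q, c, hqs, hqi, hqa, hqc⟩ := exists_projection_eq_mul a ha
  have hφ : ∀ (φ : F₁ →⋆ₙₐ[ℂ] (∀ j : Fin k, MatAlg (r j))) (j : Fin k),
      IsRangeProjection (φ a j) (φ q j) := by
    intro φ j
    refine isRangeProjection_of_eq_mul (c := φ c j) ?_ ?_ ?_ ?_
    · have := congrArg (fun x => φ x j) hqs.star_eq
      rw [isSelfAdjoint_iff]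
      simpa only [map_star, Pi.star_apply] using this
    · have := congrArg (fun x => φ x j) hqi
      simpa only [map_mul, Pi.mul_apply] using this
    · have := congrArg (fun x => φ x j) hqa
      simpa only [map_mul, Pi.mul_apply] using this
    · have := congrArg (fun x => φ x j) hqc
      simpa only [map_mul, Pi.mul_apply] using this
  have hP : ∀ (j : Fin k) (t : I), IsRangeProjection (h t j)
      (∑ i, (if 0 < μ j i t then 1 else 0 : ℂ) • p j i t) := fun j t =>
    isRangeProjection_sum_smul (fun i => hs j i t) (fun i => hi j i t)
      (fun i i' hii => horth j i i' hii t) _ _ fun i => (hμ0 j i t).lt_iff_ne'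
  refine ⟨h, fun t j => ?_, fun t j => ?_, ?_, ⟨hz.trans hg0, ho.trans hg1⟩,
    fun j t => ∑ i, (if 0 < μ j i t then 1 else 0 : ℂ) • p j i t, hP, q,
    isRangeProjection_of_eq_mul hqs hqi hqa hqc, fun j => ?_⟩
  · exact isPositive_sum_smul (fun i => hs j i t) (fun i => hi j i t) fun i => hμ0 j i t
  · rw [hsub]
    exact isPositive_sum_smul (fun i => hs j i t) (fun i => hi j i t) fun i =>
      sub_nonneg.2 (hμle j i t)
  · rw [ContinuousMap.norm_lt_iff _ hε]
    refine fun t => (pi_norm_lt_iff hε).2 fun j => lt_of_le_of_lt ?_ hδε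
    change ‖h t j - g t j‖ ≤ _
    rw [norm_sub_rev, hsub]
    calc ‖∑ i, ((lam j i t - μ j i t : ℝ) : ℂ) • p j i t‖
        ≤ ∑ _i : Fin (r j), 3 * δ := by
          refine norm_sum_le_of_le _ fun i _ => ?_
          rw [norm_smul, Complex.norm_real, Real.norm_of_nonneg (sub_nonneg.2 (hμle j i t))]
          exact (mul_le_of_le_one_right (sub_nonneg.2 (hμle j i t))
            ((hs j i t).norm_le_one_of_mul_self (hi j i t))).trans (hμδ j i t)
      _ = r j * (3 * δ) := by simp
      _ ≤ (∑ j, r j : ℕ) * (3 * δ) := by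
          gcongr
          exact Finset.single_le_sum (fun _ _ => Nat.zero_le _) (Finset.mem_univ j)
  · obtain ⟨t, Pp, Pm, h1, h2, h3, h4, h5, h6, h7, h8, h9, h10⟩ :=
      exists_rangeProjection_partition (p j) (hs j) (hi j) (horth j) (hrank1 j) (μ j) (S j)
        (hcell j) (hint j) (hSz j) (hSo j) _ fun _ => rfl
    refine ⟨m, t, Pp, Pm, h1, h2, h3, h4, h5, h6, h7, h8, ⟨?_, h9⟩, ⟨?_, h10⟩⟩
    · exact (hφ φ₀ j).unique (hg0 ▸ hz ▸ hP j 0)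
    · exact (hφ φ₁ j).unique (hg1 ▸ ho ▸ hP j 1)
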